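/- The sum formula for triple zeta values: for any integer l ≥ 4, Σ_{l1≥2, l2,l3≥1, l1+l2+l3=l} ζ(l1,l2,l3) = ζ(l), where ζ(l1,l2,l3) = Σ_{m1>m2>m3>0} 1/(m1^{l1} m2^{l2} m3^{l3}). -/

import Mathlib

/-- Riemann zeta value -/
noncomputable def rz (l : ℕ) : ℝ :=
  ∑' m : ℕ, if 0 < m then 1 / (m : ℝ) ^ l else 0

/-- double zeta value -/
noncomputable def dz (a b : ℕ) : ℝ :=
  ∑' p : ℕ × ℕ, if p.2 < p.1 ∧ 0 < p.2 then
    1 / ((p.1 : ℝ) ^ a * (p.2 : ℝ) ^ b) else 0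

/-- triple zeta value -/
noncomputable def tz (a b c : ℕ) : ℝ :=
  ∑' t : ℕ × ℕ × ℕ, if t.2.1 < t.1 ∧ t.2.2 < t.2.1 ∧ 0 < t.2.2 then
    1 / ((t.1 : ℝ) ^ a * (t.2.1 : ℝ) ^ b * (t.2.2 : ℝ) ^ c) else 0

/-- admissible triple indices of weight l -/
def TIdx (l : ℕ) : Finset (ℕ × ℕ × ℕ) :=
  (Finset.range (l + 1) ×ˢ Finset.range (l + 1) ×ˢ Finset.range (l + 1)).filter
    (fun t => 2 ≤ t.1 ∧ 1 ≤ t.2.1 ∧ 1 ≤ t.2.2 ∧ t.1 + t.2.1 + t.2.2 = l)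

open scoped ENNReal

/-- The rising product `∏_{i=1}^{n} (i - x)`. -/
noncomputable def shiftedFactorial (x : ℝ) (n : ℕ) : ℝ :=
  ∏ i ∈ Finset.range n, ((i : ℝ) + 1 - x)

/-- The connector `C_x(m, n) = ∏_{i ≤ m} (i - x) ∏_{i ≤ n} (i - x) / ∏_{i ≤ m + n} (i - x)`. -/
noncomputable def connector (x : ℝ) (m n : ℕ) : ℝ :=
  shiftedFactorial x m * shiftedFactorial x n / shiftedFactorial x (m + n)

/-- The weight `1 / (b - x)` restricted to `a < b`. -/
noncomputable def succWeight (x : ℝ) (a b : ℕ) : ℝ≥0∞ :=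
  if a < b then ENNReal.ofReal (1 / ((b : ℝ) - x)) else 0

/-- The summand of `tz`, as an extended nonnegative real. -/
noncomputable def tzTerm (a b c : ℕ) (t : ℕ × ℕ × ℕ) : ℝ≥0∞ :=
  if t.2.1 < t.1 ∧ t.2.2 < t.2.1 ∧ 0 < t.2.2 then
    ENNReal.ofReal (1 / ((t.1 : ℝ) ^ a * (t.2.1 : ℝ) ^ b * (t.2.2 : ℝ) ^ c)) else 0

/-- The summand of `rz`, as an extended nonnegative real. -/
noncomputable def rzTerm (l m : ℕ) : ℝ≥0∞ :=
  if 0 < m then ENNReal.ofReal (1 / (m : ℝ) ^ l) else 0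

section Connector

variable {x : ℝ}

lemma shiftedFactorial_succ (x : ℝ) (n : ℕ) :
    shiftedFactorial x (n + 1) = shiftedFactorial x n * ((n : ℝ) + 1 - x) :=
  Finset.prod_range_succ _ _

lemma shiftedFactorial_pos (hx : x < 1) (n : ℕ) : 0 < shiftedFactorial x n :=
  Finset.prod_pos fun i _ => by
    have : (0 : ℝ) ≤ i := i.cast_nonneg
    linarith

lemma connector_comm (x : ℝ) (m n : ℕ) : connector x m n = connector x n m := by
  rw [connector, connector, mul_comm (shiftedFactorial x m), add_comm m]

lemma connector_pos (hx : x < 1) (m n : ℕ) : 0 < connector x m n :=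
  div_pos (mul_pos (shiftedFactorial_pos hx m) (shiftedFactorial_pos hx n))
    (shiftedFactorial_pos hx _)

lemma connector_zero_right (hx : x < 1) (m : ℕ) : connector x m 0 = 1 := by
  have h := (shiftedFactorial_pos hx m).ne'
  have h0 : shiftedFactorial x 0 = 1 := Finset.prod_range_zero _
  rw [connector, h0, mul_one, add_zero, div_self h]

lemma connector_succ_mul (hx : x < 1) (m n : ℕ) :
    connector x m (n + 1) * ((m : ℝ) + n + 1 - x) = connector x m n * ((n : ℝ) + 1 - x) := by
  have h := (shiftedFactorial_pos hx (m + n)).ne'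
  have hmn : (m : ℝ) + n + 1 - x ≠ 0 := by
    have : (0 : ℝ) ≤ m := m.cast_nonneg
    have : (0 : ℝ) ≤ n := n.cast_nonneg
    linarith
  rw [connector, connector, ← add_assoc, shiftedFactorial_succ, shiftedFactorial_succ]
  push_cast
  field_simp

lemma connector_sub_connector_succ (hx : x < 1) {m : ℕ} (hm : 0 < m) (n : ℕ) :
    connector x m (n + 1) / ((n : ℝ) + 1 - x) =
      connector x m n / m - connector x m (n + 1) / m := by
  have h := connector_succ_mul hx m n
  have hm' : (m : ℝ) ≠ 0 := by positivity
  have hn : (n : ℝ) + 1 - x ≠ 0 := by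
    have : (0 : ℝ) ≤ n := n.cast_nonneg
    linarith
  field_simp
  linarith

lemma connector_mul_le_one (hx0 : 0 ≤ x) (hx : x < 1) {m : ℕ} (hm : 0 < m) (n : ℕ) :
    connector x m n * ((n : ℝ) + 1 - x) ≤ 1 := by
  induction n with
  | zero =>
    rw [connector_zero_right hx]
    push_cast
    linarith
  | succ n ih =>
    rw [← connector_succ_mul hx] at ih
    refine le_trans ?_ ih
    have hm' : (1 : ℝ) ≤ m := by exact_mod_cast hm
    refine mul_le_mul_of_nonneg_left ?_ (connector_pos hx _ _).le
    push_cast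
    linarith

lemma tendsto_connector (hx0 : 0 ≤ x) (hx : x < 1) {m : ℕ} (hm : 0 < m) :
    Filter.Tendsto (connector x m) Filter.atTop (nhds 0) := by
  have hlim : Filter.Tendsto (fun n : ℕ => 1 / ((n : ℝ) + (1 - x))) Filter.atTop (nhds 0) := by
    simp only [one_div]
    exact tendsto_inv_atTop_zero.comp
      (Filter.tendsto_atTop_add_const_right _ _ tendsto_natCast_atTop_atTop)
  refine squeeze_zero (fun n => (connector_pos hx m n).le) (fun n => ?_) hlim
  have hn : (0 : ℝ) ≤ n := n.cast_nonneg
  rw [le_div_iff₀ (by linarith), ← add_sub_assoc]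
  exact connector_mul_le_one hx0 hx hm n

lemma hasSum_connector (hx0 : 0 ≤ x) (hx : x < 1) {m : ℕ} (hm : 0 < m) (n : ℕ) :
    HasSum (fun k : ℕ => connector x m (n + k + 1) / (((n + k : ℕ) : ℝ) + 1 - x))
      (connector x m n / m) := by
  have hnn : ∀ k : ℕ, 0 ≤ connector x m (n + k + 1) / (((n + k : ℕ) : ℝ) + 1 - x) := fun k => by
    have : (0 : ℝ) ≤ ((n + k : ℕ) : ℝ) := Nat.cast_nonneg _
    exact div_nonneg (connector_pos hx _ _).le (by linarith)
  rw [hasSum_iff_tendsto_nat_of_nonneg hnn]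
  have hsum : ∀ N : ℕ, ∑ k ∈ Finset.range N,
      connector x m (n + k + 1) / (((n + k : ℕ) : ℝ) + 1 - x) =
        connector x m n / m - connector x m (N + n) / m := fun N => by
    simp only [connector_sub_connector_succ hx hm]
    rw [add_comm N n]
    exact Finset.sum_range_sub' (fun k => connector x m (n + k) / (m : ℝ)) N
  simp only [hsum]
  have h := ((Filter.tendsto_add_atTop_iff_nat n).2 (tendsto_connector hx0 hx hm)).div_const (m : ℝ)
  simpa using h.const_sub (connector x m n / m)

lemma tsum_succWeight_mul_connector (hx0 : 0 ≤ x) (hx : x < 1) {m : ℕ} (hm : 0 < m) (n : ℕ) :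
    ∑' a, succWeight x n a * ENNReal.ofReal (connector x m a) =
      ENNReal.ofReal (1 / m) * ENNReal.ofReal (connector x m n) := by
  have hinj : Function.Injective fun k : ℕ => n + k + 1 := fun a b h => by
    simpa using h
  have hsupp : (Function.support fun a => succWeight x n a * ENNReal.ofReal (connector x m a)) ⊆
      Set.range fun k : ℕ => n + k + 1 := fun a ha => by
    have hna : n < a := by
      by_contra hna
      simp [succWeight, hna] at ha
    exact ⟨a - n - 1, by simp only []; omega⟩
  have hterm : ∀ k : ℕ, succWeight x n (n + k + 1) * ENNReal.ofReal (connector x m (n + k + 1)) =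
      ENNReal.ofReal (connector x m (n + k + 1) / (((n + k : ℕ) : ℝ) + 1 - x)) := fun k => by
    have : (0 : ℝ) ≤ ((n + k : ℕ) : ℝ) := Nat.cast_nonneg _
    rw [succWeight, if_pos (by omega), Nat.cast_succ,
      ← ENNReal.ofReal_mul (one_div_nonneg.2 (by linarith)), one_div_mul_eq_div]
  have hs := hasSum_connector hx0 hx hm n
  rw [← hinj.tsum_eq hsupp]
  simp only [hterm]
  rw [← ENNReal.ofReal_tsum_of_nonneg _ hs.summable, hs.tsum_eq,
    ← ENNReal.ofReal_mul (by positivity), one_div_mul_eq_div]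
  intro k
  have : (0 : ℝ) ≤ ((n + k : ℕ) : ℝ) := Nat.cast_nonneg _
  exact div_nonneg (connector_pos hx _ _).le (by linarith)

/-- Generating function form of the sum formula of depth three. -/
lemma tsum_succWeight_triple (hx0 : 0 ≤ x) (hx : x < 1) :
    ∑' a, ∑' b, ∑' c, succWeight x 0 a * succWeight x a b * succWeight x b c *
        ENNReal.ofReal (1 / c) =
      ∑' m : ℕ, succWeight x 0 m * ENNReal.ofReal (1 / m) ^ 3 := by
  have hR : ∀ m : ℕ, succWeight x 0 m * ENNReal.ofReal (1 / m) ^ 3 =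
      ∑' a, ∑' b, ∑' c, succWeight x 0 m * succWeight x 0 a * succWeight x a b *
        succWeight x b c * ENNReal.ofReal (connector x m c) := fun m => by
    rcases Nat.eq_zero_or_pos m with rfl | hm
    · simp [succWeight]
    · simp only [mul_assoc, ENNReal.tsum_mul_left, tsum_succWeight_mul_connector hx0 hx hm]
      simp only [mul_left_comm _ (ENNReal.ofReal (1 / m)), ENNReal.tsum_mul_left,
        tsum_succWeight_mul_connector hx0 hx hm, connector_zero_right hx, ENNReal.ofReal_one]
      ring
  have hL : ∀ a b c : ℕ, succWeight x 0 a * succWeight x a b * succWeight x b c *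
      ENNReal.ofReal (1 / c) = ∑' m, succWeight x 0 m * succWeight x 0 a * succWeight x a b *
        succWeight x b c * ENNReal.ofReal (connector x m c) := fun a b c => by
    rcases Nat.eq_zero_or_pos c with rfl | hc
    · simp [succWeight]
    · have h := tsum_succWeight_mul_connector hx0 hx hc 0
      rw [connector_zero_right hx, ENNReal.ofReal_one, mul_one] at h
      rw [← h, ← ENNReal.tsum_mul_left]
      refine tsum_congr fun m => ?_
      rw [connector_comm]
      ring
  simp only [hR, hL]
  symm
  exact ENNReal.tsum_comm.trans <| tsum_congr fun a =>
    ENNReal.tsum_comm.trans <| tsum_congr fun b => ENNReal.tsum_comm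

end Connector

section PowerSeries

lemma ENNReal.tsum_mul_pow_eq_add (a : ℕ → ℝ≥0∞) (y : ℝ≥0∞) :
    ∑' n, a n * y ^ n = a 0 + y * ∑' n, a (n + 1) * y ^ n := by
  rw [tsum_eq_zero_add' ENNReal.summable, ← ENNReal.tsum_mul_left]
  simp only [pow_zero, mul_one, pow_succ]
  congr 1
  exact tsum_congr fun n => by ring

lemma ENNReal.coeff_zero_le_of_tsum_mul_pow_eq {a b : ℕ → ℝ≥0∞} {r : ℝ≥0∞} (hr : 0 < r)
    (hb : ∑' n, b n * r ^ n ≠ ∞)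
    (h : ∀ y, 0 < y → y ≤ r → ∑' n, a n * y ^ n = ∑' n, b n * y ^ n) : a 0 ≤ b 0 := by
  set M := ∑' n, b (n + 1) * r ^ n
  have hM : M ≠ ∞ := fun hM => hb <| by
    rw [ENNReal.tsum_mul_pow_eq_add, show ∑' n, b (n + 1) * r ^ n = ∞ from hM,
      ENNReal.mul_top hr.ne', add_top]
  have hle : ∀ y, 0 < y → y ≤ r → a 0 ≤ b 0 + y * M := fun y hy hyr => by
    have hy' := h y hy hyr
    rw [ENNReal.tsum_mul_pow_eq_add, ENNReal.tsum_mul_pow_eq_add b] at hy'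
    refine le_self_add.trans (hy'.le.trans ?_)
    gcongr
    exact ENNReal.tsum_le_tsum fun n => by gcongr
  have hlim : Filter.Tendsto (fun y : ℝ≥0∞ => b 0 + y * M) (nhdsWithin 0 (Set.Ioi 0))
      (nhds (b 0 + 0 * M)) :=
    (tendsto_const_nhds.add (ENNReal.Tendsto.mul_const Filter.tendsto_id (Or.inr hM))).mono_left
      nhdsWithin_le_nhds
  rw [zero_mul, add_zero] at hlim
  refine ge_of_tendsto hlim ?_
  filter_upwards [Ioc_mem_nhdsGT hr] with y hy using hle y hy.1 hy.2

lemma ENNReal.coeff_eq_of_tsum_mul_pow_eq {r : ℝ≥0∞} (hr : 0 < r) (hr' : r ≠ ∞) (n : ℕ) :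
    ∀ {a b : ℕ → ℝ≥0∞}, ∑' n, b n * r ^ n ≠ ∞ →
      (∀ y, 0 < y → y ≤ r → ∑' n, a n * y ^ n = ∑' n, b n * y ^ n) → a n = b n := by
  have hzero : ∀ {a b : ℕ → ℝ≥0∞}, ∑' n, b n * r ^ n ≠ ∞ →
      (∀ y, 0 < y → y ≤ r → ∑' n, a n * y ^ n = ∑' n, b n * y ^ n) → a 0 = b 0 :=
    fun hb h => le_antisymm (ENNReal.coeff_zero_le_of_tsum_mul_pow_eq hr hb h)
      (ENNReal.coeff_zero_le_of_tsum_mul_pow_eq hr (by rwa [h r hr le_rfl])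
        fun y hy hyr => (h y hy hyr).symm)
  induction n with
  | zero => exact hzero
  | succ n ih =>
    intro a b hb h
    have h0 := hzero hb h
    rw [ENNReal.tsum_mul_pow_eq_add, ENNReal.add_ne_top] at hb
    refine ih (a := fun n => a (n + 1)) (b := fun n => b (n + 1)) (fun hM => hb.2 ?_)
      fun y hy hyr => ?_
    · rw [hM, ENNReal.mul_top hr.ne']
    · have hy' := h y hy hyr
      rw [ENNReal.tsum_mul_pow_eq_add, ENNReal.tsum_mul_pow_eq_add b, h0,
        ENNReal.add_right_inj hb.1] at hy'
      exact (ENNReal.mul_right_inj hy.ne' (hyr.trans_lt hr'.lt_top).ne).1 hy'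

end PowerSeries

section Expansion

variable {x : ℝ}

lemma ofReal_one_div_sub_eq_tsum (hx0 : 0 ≤ x) (hx : x < 1) {m : ℕ} (hm : 0 < m) :
    ENNReal.ofReal (1 / ((m : ℝ) - x)) =
      ∑' k : ℕ, ENNReal.ofReal (1 / (m : ℝ)) ^ (k + 1) * ENNReal.ofReal x ^ k := by
  have hm' : (1 : ℝ) ≤ m := by exact_mod_cast hm
  have h1 : x / m < 1 := by rw [div_lt_one (by linarith)]; linarith
  have h0 : 0 ≤ x / m := by positivity
  have hs := (hasSum_geometric_of_lt_one h0 h1).mul_left (1 / (m : ℝ))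
  have hval : 1 / (m : ℝ) * (1 - x / m)⁻¹ = 1 / ((m : ℝ) - x) := by
    have : (m : ℝ) - x ≠ 0 := by linarith
    field_simp
  rw [← hval, ← hs.tsum_eq, ENNReal.ofReal_tsum_of_nonneg (fun n => by positivity) hs.summable]
  refine tsum_congr fun k => ?_
  rw [← ENNReal.ofReal_pow (by positivity), ← ENNReal.ofReal_pow hx0,
    ← ENNReal.ofReal_mul (by positivity)]
  congr 1
  rw [div_pow, div_pow, one_pow, pow_succ]
  field_simp

lemma tsum_rzTerm_mul_pow (hx0 : 0 ≤ x) (hx : x < 1) :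
    ∑' w : ℕ, (∑' m, rzTerm (w + 4) m) * ENNReal.ofReal x ^ w =
      ∑' m : ℕ, succWeight x 0 m * ENNReal.ofReal (1 / m) ^ 3 := by
  simp only [← ENNReal.tsum_mul_right]
  rw [ENNReal.tsum_comm]
  refine tsum_congr fun m => ?_
  rcases Nat.eq_zero_or_pos m with rfl | hm
  · simp [succWeight, rzTerm]
  · rw [succWeight, if_pos hm, ofReal_one_div_sub_eq_tsum hx0 hx hm, ← ENNReal.tsum_mul_right]
    refine tsum_congr fun w => ?_
    rw [rzTerm, if_pos hm, ← one_div_pow, ENNReal.ofReal_pow (by positivity)]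
    ring

lemma sum_TIdx_eq_tsum (f : ℕ × ℕ × ℕ → ℝ≥0∞) (w : ℕ) :
    ∑ t ∈ TIdx (w + 4), f t = ∑' s : ℕ × ℕ × ℕ,
      if s.1 + s.2.1 + s.2.2 = w then f (s.1 + 2, s.2.1 + 1, s.2.2 + 1) else 0 := by
  classical
  have hinj : Function.Injective fun s : ℕ × ℕ × ℕ => (s.1 + 2, s.2.1 + 1, s.2.2 + 1) := by
    rintro ⟨a, b, c⟩ ⟨a', b', c'⟩ h
    simpa using h
  have hsupp : (Function.support fun t => if t ∈ TIdx (w + 4) then f t else 0) ⊆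
      Set.range fun s : ℕ × ℕ × ℕ => (s.1 + 2, s.2.1 + 1, s.2.2 + 1) := by
    rintro ⟨a, b, c⟩ ht
    have ht' : (a, b, c) ∈ TIdx (w + 4) := by
      by_contra h
      simp [h] at ht
    simp only [TIdx, Finset.mem_filter] at ht'
    exact ⟨(a - 2, b - 1, c - 1), by ext <;> simp only [] <;> omega⟩
  have hsum : ∑ t ∈ TIdx (w + 4), f t = ∑' t, if t ∈ TIdx (w + 4) then f t else 0 := by
    rw [tsum_eq_sum (s := TIdx (w + 4)) fun t ht => if_neg ht]
    exact Finset.sum_congr rfl fun t ht => (if_pos ht).symm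
  rw [hsum, ← hinj.tsum_eq hsupp]
  refine tsum_congr fun s => if_congr ?_ rfl rfl
  simp only [TIdx, Finset.mem_filter, Finset.mem_product, Finset.mem_range]
  omega

lemma tsum_sum_TIdx_mul_pow (f : ℕ × ℕ × ℕ → ℝ≥0∞) (y : ℝ≥0∞) :
    ∑' w : ℕ, (∑ t ∈ TIdx (w + 4), f t) * y ^ w =
      ∑' s : ℕ × ℕ × ℕ, f (s.1 + 2, s.2.1 + 1, s.2.2 + 1) * y ^ (s.1 + s.2.1 + s.2.2) := by
  simp only [sum_TIdx_eq_tsum, ← ENNReal.tsum_mul_right]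
  rw [ENNReal.tsum_comm]
  refine tsum_congr fun s => ?_
  rw [tsum_eq_single (s.1 + s.2.1 + s.2.2) fun w hw => by rw [if_neg hw.symm, zero_mul],
    if_pos rfl]

lemma tsum_tzTerm_mul_pow (hx0 : 0 ≤ x) (hx : x < 1) :
    ∑' w : ℕ, (∑ t ∈ TIdx (w + 4), ∑' n, tzTerm t.1 t.2.1 t.2.2 n) * ENNReal.ofReal x ^ w =
      ∑' a, ∑' b, ∑' c, succWeight x 0 a * succWeight x a b * succWeight x b c *
        ENNReal.ofReal (1 / c) := by
  have hrhs : ∑' a, ∑' b, ∑' c, succWeight x 0 a * succWeight x a b * succWeight x b c *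
      ENNReal.ofReal (1 / c) = ∑' n : ℕ × ℕ × ℕ, succWeight x 0 n.2.2 *
        succWeight x n.2.2 n.2.1 * succWeight x n.2.1 n.1 * ENNReal.ofReal (1 / n.1) := by
    simp only [ENNReal.tsum_prod']
    rw [tsum_congr fun a => ENNReal.tsum_comm, ENNReal.tsum_comm]
    exact tsum_congr fun c => ENNReal.tsum_comm
  rw [hrhs, tsum_sum_TIdx_mul_pow fun t => ∑' n, tzTerm t.1 t.2.1 t.2.2 n]
  simp only [← ENNReal.tsum_mul_right]
  rw [ENNReal.tsum_comm]
  refine tsum_congr fun ⟨c, b, a⟩ => ?_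
  by_cases h : b < c ∧ a < b ∧ 0 < a
  · have ⟨hbc, hab, ha⟩ := h
    have hb : 0 < b := ha.trans hab
    simp only [tzTerm, if_pos h, succWeight, if_pos hbc, if_pos hab, if_pos ha]
    rw [ofReal_one_div_sub_eq_tsum hx0 hx ha, ofReal_one_div_sub_eq_tsum hx0 hx hb,
      ofReal_one_div_sub_eq_tsum hx0 hx (hb.trans hbc)]
    have hterm : ∀ i j k : ℕ,
        ENNReal.ofReal (1 / ((c : ℝ) ^ (i + 2) * (b : ℝ) ^ (j + 1) * (a : ℝ) ^ (k + 1))) *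
            ENNReal.ofReal x ^ (i + j + k) =
          ENNReal.ofReal (1 / c) * ((ENNReal.ofReal (1 / c) ^ (i + 1) * ENNReal.ofReal x ^ i) *
            ((ENNReal.ofReal (1 / b) ^ (j + 1) * ENNReal.ofReal x ^ j) *
              (ENNReal.ofReal (1 / a) ^ (k + 1) * ENNReal.ofReal x ^ k))) := fun i j k => by
      rw [← one_div_mul_one_div, ← one_div_mul_one_div, ← one_div_pow, ← one_div_pow,
        ← one_div_pow, ENNReal.ofReal_mul (by positivity),
        ENNReal.ofReal_mul (by positivity), ENNReal.ofReal_pow (by positivity),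
        ENNReal.ofReal_pow (by positivity), ENNReal.ofReal_pow (by positivity)]
      ring
    simp only [ENNReal.tsum_prod', hterm, ENNReal.tsum_mul_left, ENNReal.tsum_mul_right]
    ring
  · have hzero : succWeight x 0 a * succWeight x a b * succWeight x b c = 0 := by
      simp only [succWeight]
      split_ifs <;> simp_all
    simp only [tzTerm, if_neg h, zero_mul, tsum_zero, hzero]

end Expansion

theorem sum_formula_triple (l : ℕ) (hl : 4 ≤ l) :
    (∑ t ∈ TIdx l, tz t.1 t.2.1 t.2.2) = rz l := by
  obtain ⟨w, rfl⟩ := Nat.exists_eq_add_of_le' hl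
  have hrz_ne_top : ∑' w : ℕ, (∑' m, rzTerm (w + 4) m) * (2⁻¹ : ℝ≥0∞) ^ w ≠ ∞ := by
    have hle : ∀ w m, rzTerm (w + 4) m ≤ rzTerm 2 m := fun w m => by
      unfold rzTerm
      split_ifs with hm
      · have hm' : (1 : ℝ) ≤ m := by exact_mod_cast hm
        gcongr
        omega
      · exact le_rfl
    have hfin : ∑' m, rzTerm 2 m ≠ ∞ := by
      refine ne_top_of_le_ne_top (Real.summable_one_div_nat_pow.2 one_lt_two).tsum_ofReal_ne_top
        (ENNReal.tsum_le_tsum fun m => ?_)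
      unfold rzTerm
      split_ifs <;> simp
    refine ne_top_of_le_ne_top ?_ (ENNReal.tsum_le_tsum fun w =>
      mul_le_mul_left (ENNReal.tsum_le_tsum (hle w)) ((2⁻¹ : ℝ≥0∞) ^ w))
    rw [ENNReal.tsum_mul_left, ENNReal.tsum_geometric, ENNReal.one_sub_inv_two, inv_inv]
    exact ENNReal.mul_ne_top hfin (by simp)
  have hcoeff : ∑ t ∈ TIdx (w + 4), ∑' n, tzTerm t.1 t.2.1 t.2.2 n = ∑' m, rzTerm (w + 4) m := by
    refine ENNReal.coeff_eq_of_tsum_mul_pow_eq (r := 2⁻¹) (by simp) (by simp) w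
      (a := fun w => ∑ t ∈ TIdx (w + 4), ∑' n, tzTerm t.1 t.2.1 t.2.2 n)
      (b := fun w => ∑' m, rzTerm (w + 4) m) hrz_ne_top fun y _ hy => ?_
    have hy1 : y < 1 := hy.trans_lt (by simp)
    have hyx : ENNReal.ofReal y.toReal = y := ENNReal.ofReal_toReal hy1.ne_top
    have hx : y.toReal < 1 := by
      simpa using (ENNReal.toReal_lt_toReal hy1.ne_top ENNReal.one_ne_top).2 hy1
    have h := tsum_tzTerm_mul_pow ENNReal.toReal_nonneg hx
    rw [tsum_succWeight_triple ENNReal.toReal_nonneg hx,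
      ← tsum_rzTerm_mul_pow ENNReal.toReal_nonneg hx, hyx] at h
    exact h
  have hrz_w : ∑' m, rzTerm (w + 4) m ≠ ∞ := fun htop =>
    hrz_ne_top <| ENNReal.tsum_eq_top_of_eq_top ⟨w, by
      rw [htop, ENNReal.top_mul (pow_ne_zero _ (by simp))]⟩
  have htz : ∀ a b c, tz a b c = (∑' n, tzTerm a b c n).toReal := fun a b c => by
    rw [ENNReal.tsum_toReal_eq fun n => by
      unfold tzTerm
      split_ifs
      exacts [ENNReal.ofReal_ne_top, ENNReal.zero_ne_top], tz]
    refine tsum_congr fun n => ?_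
    rw [tzTerm]
    split_ifs
    · rw [ENNReal.toReal_ofReal (by positivity)]
    · simp
  have hrz : rz (w + 4) = (∑' m, rzTerm (w + 4) m).toReal := by
    rw [ENNReal.tsum_toReal_eq fun n => by
      unfold rzTerm
      split_ifs
      exacts [ENNReal.ofReal_ne_top, ENNReal.zero_ne_top], rz]
    refine tsum_congr fun n => ?_
    rw [rzTerm]
    split_ifs
    · rw [ENNReal.toReal_ofReal (by positivity)]
    · simp
  simp only [htz]
  rw [hrz, ← hcoeff, ENNReal.toReal_sum]
  rw [← hcoeff] at hrz_w
  exact ENNReal.sum_ne_top.1 hrz_w
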